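/- arXiv:1506.02873 — 6 statements merged into one kernel-verified Lean document; each statement's English description precedes it below -/
import Mathlib

section
/- Let E ⊆ 𝕋^d be simple and compact with finitely many connected components E₁, …, E_N, and let b, c ∈ 𝕋^d be such that both b·E and c·E are very simple. Then for every j ∈ {1, …, N} there exists a constant θ_j^{(b,c)} ∈ (2πℤ)^d such that for all z ∈ E_j, arg(c·z) = arg(b·z) + arg(c·b⁻¹) + θ_j^{(b,c)}. -/
open scoped Real
noncomputable section

/-- The torus `𝕋^d = (𝕊¹)^d`. -/
abbrev Torus (d : ℕ) := Fin d → Circle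

variable {d : ℕ}

/-- Componentwise multiplication of a set by a point: `a·E = {a·z : z ∈ E}`. -/
def smulSet (a : Torus d) (E : Set (Torus d)) : Set (Torus d) := (fun z => a * z) '' E

/-- The componentwise principal argument `arg : 𝕋^d → (−π,π]^d`. -/
def targ (z : Torus d) : Fin d → ℝ := fun j => Complex.arg (z j)

/-- `arg(E)` for a subset `E ⊆ 𝕋^d`. -/
def argSet (E : Set (Torus d)) : Set (Fin d → ℝ) := targ '' E

/-- The Euclidean norm on `ℝ^d`. -/
def eunorm (v : Fin d → ℝ) : ℝ := Real.sqrt (∑ j, v j ^ 2)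

/-- The distance `d^{𝕋^d}(z,w) = min_{θ ∈ (2πℤ)^d} ‖arg z − arg w + θ‖`. -/
def torusDist (z w : Torus d) : ℝ :=
  sInf {r | ∃ θ : Fin d → ℤ, r = eunorm (fun j => targ z j - targ w j + 2 * π * θ j)}

/-- The Hausdorff distance on `𝕋^d` induced by `torusDist`. -/
def torusHD (A B : Set (Torus d)) : ℝ :=
  sInf {ε | 0 < ε ∧ (∀ a ∈ A, ∃ b ∈ B, torusDist a b ≤ ε) ∧
      (∀ b ∈ B, ∃ a ∈ A, torusDist a b ≤ ε)}

/-- `E ⊆ 𝕋^d` is very simple if no coordinate of a point of `E` equals `−1`. -/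
def VerySimple (E : Set (Torus d)) : Prop := ∀ z ∈ E, ∀ j, (z j : ℂ) ≠ -1

/-- `E ⊆ 𝕋^d` is simple if no coordinate projection restricted to `E` is onto. -/
def Simple (E : Set (Torus d)) : Prop := ∀ j, (fun z : Torus d => z j) '' E ≠ Set.univ

/-- `E` has finitely many connected components. -/
def FinComps (E : Set (Torus d)) : Prop :=
  {C : Set (Torus d) | ∃ z ∈ E, C = connectedComponentIn E z}.Finite

/-- `E₁, …, E_N` are the connected components of `E`. -/
def IsConnComps {N : ℕ} (E : Set (Torus d)) (Ec : Fin N → Set (Torus d)) : Prop :=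
  (∀ i, ∃ z ∈ E, Ec i = connectedComponentIn E z) ∧ (∀ z ∈ E, ∃ i, z ∈ Ec i) ∧
    Function.Injective Ec

/-- `exp(iF) ⊆ 𝕋^d` for `F ⊆ ℝ^d`. -/
def expSet (F : Set (Fin d → ℝ)) : Set (Torus d) :=
  {z | ∃ θ ∈ F, ∀ j, z j = Circle.exp (θ j)}

/-- `diam(η_j(arg(c·E)))`. -/
def etaDiam (E : Set (Torus d)) (c : Torus d) (j : Fin d) : ℝ :=
  Metric.diam ((fun z : Torus d => Complex.arg ((c j * z j : Circle) : ℂ)) '' E)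

/-- The set `Λ_j = {diam(η_j(arg(c·E))) : c·E very simple}`. -/
def Lambda (E : Set (Torus d)) (j : Fin d) : Set ℝ :=
  {r | ∃ c : Torus d, VerySimple (smulSet c E) ∧ r = etaDiam E c j}

/-- `b` is admissible for `E`. -/
def Admissible (b : Torus d) (E : Set (Torus d)) : Prop :=
  VerySimple (smulSet b E) ∧ ∀ j, IsLeast (Lambda E j) (etaDiam E b j)

/-- All phase shifts of `E` with respect to `(b,c)` are equal (to a common `θ ∈ (2πℤ)^d`). -/
def PhaseShifted (b c : Torus d) (E : Set (Torus d)) : Prop :=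
  ∃ θ : Fin d → ℤ, ∀ z ∈ E, ∀ j,
    Complex.arg ((c j * z j : Circle) : ℂ) =
      Complex.arg ((b j * z j : Circle) : ℂ) +
        Complex.arg ((c j * (b j)⁻¹ : Circle) : ℂ) + 2 * π * θ j

/-- `E` is generic: for every pair of admissible points, all the phase shifts are equal. -/
def Generic (E : Set (Torus d)) : Prop :=
  ∀ b c : Torus d, Admissible b E → Admissible c E → PhaseShifted b c E

/-- Euclidean distance between two subsets of `ℝ^d`. -/
def setDistR (A B : Set (Fin d → ℝ)) : ℝ :=
  sInf {r | ∃ x ∈ A, ∃ y ∈ B, r = eunorm (x - y)}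

/-- The boundary of the cube `[−π,π]^d`. -/
def cubeBoundary (d : ℕ) : Set (Fin d → ℝ) :=
  frontier (Set.univ.pi fun _ : Fin d => Set.Icc (-π) π)

theorem Circle.coe_mem_slitPlane {z : Circle} (hz : (z : ℂ) ≠ -1) :
    (z : ℂ) ∈ Complex.slitPlane := by
  rw [Complex.mem_slitPlane_iff_arg]
  refine ⟨fun harg => hz ?_, z.coe_ne_zero⟩
  rw [← Circle.exp_arg z, harg, Circle.coe_exp, Complex.exp_pi_mul_I]

theorem Circle.exists_arg_mul_eq_arg_mul_add (b c z : Circle) :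
    ∃ k : ℤ, Complex.arg ((c * z : Circle) : ℂ) - Complex.arg ((b * z : Circle) : ℂ) -
      Complex.arg ((c * b⁻¹ : Circle) : ℂ) = 2 * π * k := by
  have h : ((Complex.arg ((c * z : Circle) : ℂ) : ℝ) : Real.Angle) =
      ((Complex.arg ((b * z : Circle) : ℂ) + Complex.arg ((c * b⁻¹ : Circle) : ℂ) : ℝ) :
        Real.Angle) := by
    rw [Real.Angle.coe_add,
      ← Complex.arg_mul_coe_angle (Circle.coe_ne_zero _) (Circle.coe_ne_zero _), ← Circle.coe_mul,
      show b * z * (c * b⁻¹) = c * z by rw [mul_comm, mul_assoc, inv_mul_cancel_left]]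
  obtain ⟨k, hk⟩ := Real.Angle.angle_eq_iff_two_pi_dvd_sub.1 h
  exact ⟨k, by rw [← hk]; ring⟩

theorem VerySimple.continuousOn_arg {E : Set (Torus d)} {a : Torus d}
    (ha : VerySimple (smulSet a E)) (j : Fin d) :
    ContinuousOn (fun z : Torus d => Complex.arg ((a j * z j : Circle) : ℂ)) E := by
  intro z hz
  have hslit := Circle.coe_mem_slitPlane (ha (a * z) ⟨z, hz, rfl⟩ j)
  have hmul : Continuous fun z : Torus d => ((a j * z j : Circle) : ℂ) := by fun_prop
  exact ((Complex.continuousAt_arg hslit).comp (f := fun z : Torus d => ((a j * z j : Circle) : ℂ))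
    hmul.continuousAt).continuousWithinAt

/-- On a preconnected set, the phase shift between two very simple translates is constant. -/
theorem IsPreconnected.phaseShifted {C : Set (Torus d)} (hC : IsPreconnected C) {b c : Torus d}
    (hb : VerySimple (smulSet b C)) (hc : VerySimple (smulSet c C)) : PhaseShifted b c C := by
  have hshift : ∀ j, ∃ k : ℤ, ∀ z ∈ C,
      Complex.arg ((c j * z j : Circle) : ℂ) - Complex.arg ((b j * z j : Circle) : ℂ) -
        Complex.arg ((c j * (b j)⁻¹ : Circle) : ℂ) = 2 * π * k := by
    intro j
    have hdiscrete : IsDiscrete (Set.range fun k : ℤ => 2 * π * (k : ℝ)) :=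
      ((Homeomorph.mulLeft₀ (2 * π) Real.two_pi_pos.ne').isEmbedding.comp
        Int.isClosedEmbedding_coe_real.isEmbedding).isInducing.isDiscrete_range
    obtain ⟨_, ⟨k, rfl⟩, hk⟩ := hC.eqOn_const_of_mapsTo hdiscrete
      (((hc.continuousOn_arg j).sub (hb.continuousOn_arg j)).sub
        (continuousOn_const (c := Complex.arg ((c j * (b j)⁻¹ : Circle) : ℂ))))
      (fun z _ =>
        let ⟨k, hk⟩ := Circle.exists_arg_mul_eq_arg_mul_add (b j) (c j) (z j)
        ⟨k, hk.symm⟩)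
      (Set.range_nonempty _)
    exact ⟨k, fun z hz => hk hz⟩
  choose θ hθ using hshift
  exact ⟨θ, fun z hz j => by linarith [hθ j z hz]⟩

/-- Existence of the phase shifts: if `E ⊆ 𝕋^d` is simple and compact with
connected components `E₁, …, E_N`, and `b·E`, `c·E` are very simple, then on each connected
component `E_i` there is a constant `θ_i ∈ (2πℤ)^d` with
`arg(c·z) = arg(b·z) + arg(c·b⁻¹) + θ_i` for all `z ∈ E_i`. -/
theorem exists_phase_shifts {d N : ℕ} (E : Set (Torus d)) (Ec : Fin N → Set (Torus d))
    (hS : Simple E) (hC : IsCompact E) (hcomp : IsConnComps E Ec)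
    (b c : Torus d) (hb : VerySimple (smulSet b E)) (hc : VerySimple (smulSet c E)) :
    ∀ i : Fin N, ∃ θ : Fin d → ℤ, ∀ z ∈ Ec i, ∀ j : Fin d,
      Complex.arg ((c j * z j : Circle) : ℂ) =
        Complex.arg ((b j * z j : Circle) : ℂ) +
          Complex.arg ((c j * (b j)⁻¹ : Circle) : ℂ) + 2 * π * θ j := by
  intro i
  obtain ⟨w, -, hw⟩ := hcomp.1 i
  have hsub : Ec i ⊆ E := hw ▸ connectedComponentIn_subset E w
  have hpre : IsPreconnected (Ec i) := hw ▸ isPreconnected_connectedComponentIn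
  exact hpre.phaseShifted (fun z hz => hb z (Set.image_mono hsub hz))
    (fun z hz => hc z (Set.image_mono hsub hz))
end
end

section
/- Let E ⊆ 𝕋^d be simple and compact with finitely many connected components. Then for every j ∈ {1, …, d}, the set Λ_j = {diam(η_j(arg(c·E))) : c ∈ 𝕋^d such that c·E is very simple} is a nonempty finite subset of ℝ; in particular Λ_j admits a minimum. -/
open scoped Real
noncomputable section

variable {d : ℕ}

/-- The principal argument is continuous on the circle away from `-1`. -/
lemma continuousAt_arg_circle {w : Circle} (hw : (w : ℂ) ≠ -1) :
    ContinuousAt (fun w : Circle => Complex.arg (w : ℂ)) w := by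
  refine ContinuousAt.comp (f := fun w : Circle => (w : ℂ)) (g := Complex.arg)
    (Complex.continuousAt_arg ?_) continuous_subtype_val.continuousAt
  rw [Complex.mem_slitPlane_iff_arg]
  refine ⟨fun h => hw ?_, w.coe_ne_zero⟩
  rw [← Circle.exp_arg w, h, Circle.coe_exp, Complex.exp_pi_mul_I]

/-- The arguments of `c * z` and `b * z` differ by `arg (c * b⁻¹)` up to at most one turn. -/
lemma exists_phase_shift (b c z : Circle) :
    ∃ n ∈ Set.Icc (-1 : ℤ) 1, Complex.arg ((c * z : Circle) : ℂ) =
      Complex.arg ((b * z : Circle) : ℂ) + 2 * π * n + Complex.arg ((c * b⁻¹ : Circle) : ℂ) := by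
  have h : ((Complex.arg ((c * z : Circle) : ℂ) : ℝ) : Real.Angle) =
      ((Complex.arg ((b * z : Circle) : ℂ) + Complex.arg ((c * b⁻¹ : Circle) : ℂ) : ℝ) :
        Real.Angle) := by
    rw [Real.Angle.coe_add, ← Complex.arg_mul_coe_angle (Circle.coe_ne_zero _)
      (Circle.coe_ne_zero _), ← Circle.coe_mul]
    have : b * z * (c * b⁻¹) = c * z := by
      rw [mul_comm c, ← mul_assoc, mul_inv_cancel_comm, mul_comm]
    rw [this]
  obtain ⟨n, hn⟩ := Real.Angle.angle_eq_iff_two_pi_dvd_sub.mp h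
  refine ⟨n, ?_, by linarith⟩
  have hπ := Real.pi_pos
  have h₁ := Complex.neg_pi_lt_arg ((c * z : Circle) : ℂ)
  have h₂ := Complex.arg_le_pi ((c * z : Circle) : ℂ)
  have h₃ := Complex.neg_pi_lt_arg ((b * z : Circle) : ℂ)
  have h₄ := Complex.arg_le_pi ((b * z : Circle) : ℂ)
  have h₅ := Complex.neg_pi_lt_arg ((c * b⁻¹ : Circle) : ℂ)
  have h₆ := Complex.arg_le_pi ((c * b⁻¹ : Circle) : ℂ)
  have hlo : (-2 : ℝ) < n := by nlinarith
  have hhi : (n : ℝ) < 2 := by nlinarith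
  have hlo' : (-2 : ℤ) < n := by exact_mod_cast hlo
  have hhi' : n < (2 : ℤ) := by exact_mod_cast hhi
  exact ⟨by omega, by omega⟩

lemma continuousOn_arg_mul {E : Set (Torus d)} {c : Torus d} (hc : VerySimple (smulSet c E))
    (j : Fin d) : ContinuousOn (fun z : Torus d => Complex.arg ((c j * z j : Circle) : ℂ)) E := by
  intro z hz
  have hw : ((c j * z j : Circle) : ℂ) ≠ -1 := hc (c * z) ⟨z, hz, rfl⟩ j
  have hf : ContinuousAt (fun z : Torus d => c j * z j) z :=
    (continuous_const.mul (continuous_apply j)).continuousAt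
  exact (ContinuousAt.comp (f := fun z : Torus d => c j * z j)
    (continuousAt_arg_circle hw) hf).continuousWithinAt

/-- A simple set can be rotated to a very simple one. -/
lemma Simple.exists_verySimple {E : Set (Torus d)} (hS : Simple E) :
    ∃ c : Torus d, VerySimple (smulSet c E) := by
  choose w hw using fun j => (Set.ne_univ_iff_exists_notMem _).mp (hS j)
  refine ⟨fun j => Circle.exp π * (w j)⁻¹, ?_⟩
  rintro _ ⟨z, hz, rfl⟩ j h
  refine hw j ⟨z, hz, ?_⟩
  have h' : Circle.exp π * (w j)⁻¹ * z j = Circle.exp π := by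
    apply Circle.ext
    rw [Circle.coe_exp, Complex.exp_pi_mul_I]
    exact h
  rw [mul_assoc, mul_eq_left, inv_mul_eq_one] at h'
  exact h'.symm

/-- Between two very simple rotations of `E`, the arguments change by a translation together with
a turn in `{-1, 0, 1}` on each connected component. -/
lemma etaDiam_eq_of_verySimple {E : Set (Torus d)} {b c : Torus d}
    (hb : VerySimple (smulSet b E)) (hc : VerySimple (smulSet c E)) (j : Fin d) :
    ∃ n : Torus d → Set.Icc (-1 : ℤ) 1,
      (∀ z ∈ E, ∀ w ∈ connectedComponentIn E z, n w = n z) ∧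
      etaDiam E c j = Metric.diam
        ((fun z : Torus d => Complex.arg ((b j * z j : Circle) : ℂ) + 2 * π * (n z : ℤ)) '' E) := by
  choose n hn hshift using fun z : Torus d => exists_phase_shift (b j) (c j) (z j)
  refine ⟨fun z => ⟨n z, hn z⟩, fun z hz w hw => Subtype.ext ?_, ?_⟩
  · have hcont : ContinuousOn n E := by
      rw [Int.isClosedEmbedding_coe_real.isInducing.continuousOn_iff]
      refine ((((continuousOn_arg_mul hc j).sub (continuousOn_arg_mul hb j)).sub
        (continuousOn_const (c := Complex.arg ((c j * (b j)⁻¹ : Circle) : ℂ)))).div_const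
        (2 * π)).congr fun z _ => ?_
      have hπ := Real.pi_ne_zero
      simp only [Function.comp_apply, Pi.sub_apply, hshift z]
      field_simp
      ring
    exact isPreconnected_connectedComponentIn.constant
      (hcont.mono (connectedComponentIn_subset E z)) hw (mem_connectedComponentIn hz)
  · simp only [etaDiam, hshift]
    rw [← (isometry_add_right (Complex.arg ((c j * (b j)⁻¹ : Circle) : ℂ))).diam_image
      ((fun z : Torus d => Complex.arg ((b j * z j : Circle) : ℂ) + 2 * π * n z) '' E),
      Set.image_image]

lemma Lambda_finite {E : Set (Torus d)} (hS : Simple E) (hF : FinComps E) (j : Fin d) :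
    (Lambda E j).Finite := by
  obtain ⟨b, hb⟩ := hS.exists_verySimple
  have := hF.to_subtype
  let S := {C : Set (Torus d) | ∃ z ∈ E, C = connectedComponentIn E z}
  let turn (g : S → Set.Icc (-1 : ℤ) 1) : ℝ := Metric.diam (Set.range fun z : E =>
    Complex.arg ((b j * z.1 j : Circle) : ℂ) +
      2 * π * (g ⟨connectedComponentIn E z.1, z.1, z.2, rfl⟩ : ℤ))
  refine (Set.finite_range turn).subset ?_
  rintro _ ⟨c, hc, rfl⟩
  obtain ⟨n, hconst, hdiam⟩ := etaDiam_eq_of_verySimple hb hc j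
  refine ⟨fun C => n C.2.choose, ?_⟩
  rw [hdiam, Set.image_eq_range]
  have key (z : E) : n (Exists.choose
      (⟨z.1, z.2, rfl⟩ : ∃ w ∈ E, connectedComponentIn E z.1 = connectedComponentIn E w)) =
        n z.1 := by
    generalize_proofs h
    refine hconst z.1 z.2 _ ?_
    exact h.choose_spec.2.ge <| mem_connectedComponentIn h.choose_spec.1
  simp only [turn, key]

/-- For `E ⊆ 𝕋^d` simple and compact with finitely many connected components,
each set `Λ_j = {diam(η_j(arg(c·E))) : c·E very simple}` is nonempty and finite; in particular
it admits a minimum. -/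
theorem Lambda_nonempty_finite {d : ℕ} (E : Set (Torus d))
    (hS : Simple E) (hC : IsCompact E) (hF : FinComps E) :
    ∀ j : Fin d, (Lambda E j).Nonempty ∧ (Lambda E j).Finite ∧
      ∃ m : ℝ, IsLeast (Lambda E j) m := by
  intro j
  obtain ⟨c, hc⟩ := hS.exists_verySimple
  have hne : (Lambda E j).Nonempty := ⟨_, c, hc, rfl⟩
  have hfin := Lambda_finite hS hF j
  obtain ⟨m, hm⟩ := hfin.exists_minimal hne
  exact ⟨hne, hfin, m, minimal_iff_isLeast.mp hm⟩
end
end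

section
/- Let E ⊆ 𝕋^d be simple and compact with finitely many connected components. Then there exists b ∈ 𝕋^d such that b·E is very simple and, simultaneously for every j ∈ {1, …, d}, diam(η_j(arg(b·E))) = min Λ_j, where Λ_j = {diam(η_j(arg(c·E))) : c ∈ 𝕋^d such that c·E is very simple}. Such a point b is called admissible for E. -/
open scoped Real
noncomputable section

variable {d : ℕ}

/-- The arc `{exp(it) : x < t < x + l}` is disjoint from `K ⊆ 𝕊¹`. -/
def IsGap (K : Set Circle) (x l : ℝ) : Prop :=
  ∀ t : ℝ, x < t → t < x + l → Circle.exp t ∉ K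

/-- A closed proper subset of the circle has a nontrivial gap. -/
theorem exists_isGap_pos {K : Set Circle} (hK : IsClosed K) (hne : K ≠ Set.univ) :
    ∃ x ∈ Set.Icc (-(2 * π)) (2 * π), ∃ l ∈ Set.Icc 0 (2 * π), 0 < l ∧ IsGap K x l := by
  obtain ⟨w, hw⟩ := (Set.ne_univ_iff_exists_notMem K).1 hne
  have hopen : IsOpen {t : ℝ | Circle.exp t ∉ K} :=
    hK.isOpen_compl.preimage Circle.exp.continuous
  have hmem : Complex.arg w ∈ {t : ℝ | Circle.exp t ∉ K} := by
    simpa [Circle.exp_arg] using hw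
  obtain ⟨ε, hε, hball⟩ := Metric.isOpen_iff.1 hopen _ hmem
  have hpi := Real.pi_pos
  refine ⟨Complex.arg w, ⟨?_, ?_⟩, min ε (2 * π), ⟨by positivity, min_le_right _ _⟩,
    by positivity, fun t h1 h2 => hball ?_⟩
  · linarith [Complex.neg_pi_lt_arg (w : ℂ)]
  · linarith [Complex.arg_le_pi (w : ℂ)]
  · rw [Metric.mem_ball, Real.dist_eq, abs_lt]
    constructor <;> linarith [min_le_left ε (2 * π)]

/-- Among the gaps of a closed proper subset of the circle there is a longest one. -/
theorem exists_isGap_maximal {K : Set Circle} (hK : IsClosed K) (hne : K ≠ Set.univ) :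
    ∃ x l : ℝ, 0 < l ∧ IsGap K x l ∧ ∀ x' ∈ Set.Icc (-(2 * π)) (2 * π),
      ∀ l' ∈ Set.Icc 0 (2 * π), IsGap K x' l' → l' ≤ l := by
  have hclosed : IsClosed {p : ℝ × ℝ | IsGap K p.1 p.2} := by
    have : {p : ℝ × ℝ | IsGap K p.1 p.2} =
        ⋂ t ∈ {t : ℝ | Circle.exp t ∈ K}, {p : ℝ × ℝ | t ≤ p.1} ∪ {p | p.1 + p.2 ≤ t} := by
      ext p
      simp only [IsGap, Set.mem_ofPred_eq, Set.mem_iInter, Set.mem_union]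
      refine forall_congr' fun t => ?_
      rw [← not_lt, ← not_lt]
      tauto
    rw [this]
    exact isClosed_biInter fun t _ =>
      (isClosed_le (by fun_prop) (by fun_prop)).union (isClosed_le (by fun_prop) (by fun_prop))
  obtain ⟨x₀, hx₀, l₀, hl₀, hpos, hgap⟩ := exists_isGap_pos hK hne
  have hcomp := ((isCompact_Icc (a := -(2 * π)) (b := 2 * π)).prod
    (isCompact_Icc (a := (0 : ℝ)) (b := 2 * π))).inter_right hclosed
  obtain ⟨p, hp, hmax⟩ := hcomp.exists_isMaxOn ⟨(x₀, l₀), ⟨hx₀, hl₀⟩, hgap⟩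
    (continuous_snd.continuousOn)
  exact ⟨p.1, p.2, hpos.trans_le (hmax (show (x₀, l₀) ∈ _ from ⟨⟨hx₀, hl₀⟩, hgap⟩)), hp.2,
    fun x' hx' l' hl' h => hmax (show (x', l') ∈ _ from ⟨⟨hx', hl'⟩, h⟩)⟩

/-- Rotating the midpoint of a gap of length `l` to `-1` confines the arguments to
`[-π + l/2, π - l/2]`. -/
theorem IsGap.abs_arg_le {K : Set Circle} {x l : ℝ} (h : IsGap K x l) (hl : 0 < l) {z : Circle}
    (hz : z ∈ K) :
    |Complex.arg ((Circle.exp (π - x - l / 2) * z : Circle) : ℂ)| ≤ π - l / 2 := by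
  set a := Complex.arg ((Circle.exp (π - x - l / 2) * z : Circle) : ℂ) with ha
  have hexp : z = Circle.exp (a - (π - x - l / 2)) := by
    rw [Circle.exp_sub, ha, Circle.exp_arg, mul_div_cancel_left]
  have hle : a ≤ π := Complex.arg_le_pi _
  have hgt : -π < a := Complex.neg_pi_lt_arg _
  rw [abs_le]
  constructor
  · by_contra! hlt
    refine h (a - (π - x - l / 2) + 2 * π) (by linarith) (by linarith) ?_
    rwa [Circle.exp_add, Circle.exp_two_pi, mul_one, ← hexp]
  · by_contra! hlt
    exact h (a - (π - x - l / 2)) (by linarith) (by linarith) (hexp ▸ hz)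

/-- Every rotation `c·K` determines a gap of `K` of length `2π - diam(arg(c·K))`. -/
theorem exists_isGap_of_diam (K : Set Circle) (c : Circle) :
    ∃ x ∈ Set.Icc (-(2 * π)) (2 * π), ∃ l ∈ Set.Icc 0 (2 * π),
      l = 2 * π - Metric.diam ((fun z : Circle => Complex.arg ((c * z : Circle) : ℂ)) '' K) ∧
      IsGap K x l := by
  set S := (fun z : Circle => Complex.arg ((c * z : Circle) : ℂ)) '' K with hS
  have hsub : S ⊆ Set.Icc (-π) π := by
    rintro _ ⟨z, -, rfl⟩
    exact ⟨(Complex.neg_pi_lt_arg _).le, Complex.arg_le_pi _⟩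
  have hbdd : Bornology.IsBounded S := (Metric.isBounded_Icc _ _).subset hsub
  have hpi := Real.pi_pos
  have hdiam := Real.diam_eq hbdd
  have hsup : sSup S ∈ Set.Icc (-π) π := by
    rcases S.eq_empty_or_nonempty with h | ⟨a, h⟩
    · simp [h, hpi.le]
    · exact ⟨(hsub h).1.trans (le_csSup hbdd.bddAbove h),
        csSup_le ⟨a, h⟩ fun b hb => (hsub hb).2⟩
  have hle : Metric.diam S ≤ 2 * π :=
    (Metric.diam_mono hsub (Metric.isBounded_Icc _ _)).trans_eq (by
      rw [Real.diam_Icc (by linarith)]; ring)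
  have hc1 := Complex.neg_pi_lt_arg (c : ℂ)
  have hc2 := Complex.arg_le_pi (c : ℂ)
  refine ⟨sSup S - Complex.arg c, ⟨by linarith [hsup.1], by linarith [hsup.2]⟩, _,
    ⟨by linarith, by linarith [Metric.diam_nonneg (s := S)]⟩, rfl, fun t h1 h2 ht => ?_⟩
  have hmem : Complex.arg ((c * Circle.exp t : Circle) : ℂ) ∈ S := ⟨_, ht, rfl⟩
  have hup := le_csSup hbdd.bddAbove hmem
  have hlow := csInf_le hbdd.bddBelow hmem
  obtain ⟨n, hn⟩ := Circle.exp_eq_exp.1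
    (show Circle.exp (t + Complex.arg c) =
      Circle.exp (Complex.arg ((c * Circle.exp t : Circle) : ℂ)) by
        rw [Circle.exp_arg, Circle.exp_add, Circle.exp_arg, mul_comm])
  have hn0 : (0 : ℝ) < n := by
    by_contra! h
    nlinarith
  have hn1 : (1 : ℝ) ≤ n := by exact_mod_cast Int.cast_pos.1 hn0
  nlinarith

/-- A closed proper subset of the circle can be rotated off `-1` so that the diameter of its set
of arguments is least among all rotations. -/
theorem exists_rotation_diam_arg_minimal {K : Set Circle} (hK : IsClosed K)
    (hne : K ≠ Set.univ) :
    ∃ b : Circle, (∀ z ∈ K, ((b * z : Circle) : ℂ) ≠ -1) ∧ ∀ c : Circle,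
      Metric.diam ((fun z : Circle => Complex.arg ((b * z : Circle) : ℂ)) '' K) ≤
        Metric.diam ((fun z : Circle => Complex.arg ((c * z : Circle) : ℂ)) '' K) := by
  obtain ⟨x, l, hl, hgap, hmax⟩ := exists_isGap_maximal hK hne
  refine ⟨Circle.exp (π - x - l / 2), fun z hz h => ?_, fun c => ?_⟩
  · have := (abs_le.1 (hgap.abs_arg_le hl hz)).2
    rw [h, Complex.arg_neg_one] at this
    linarith
  · obtain ⟨x', hx', l', hl', hdiam, hgap'⟩ := exists_isGap_of_diam K c
    have hll := hmax x' hx' l' hl' hgap'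
    refine Metric.diam_le_of_forall_dist_le Metric.diam_nonneg ?_
    rintro _ ⟨z, hz, rfl⟩ _ ⟨w, hw, rfl⟩
    have h1 := abs_le.1 (hgap.abs_arg_le hl hz)
    have h2 := abs_le.1 (hgap.abs_arg_le hl hw)
    rw [Real.dist_eq, abs_le]
    constructor <;> linarith [h1.1, h1.2, h2.1, h2.2]

/-- For `E ⊆ 𝕋^d` simple and compact with finitely many connected components,
there is a point `b ∈ 𝕋^d` which is admissible for `E`: `b·E` is very simple and, for every
`j`, `diam(η_j(arg(b·E))) = min Λ_j`. -/
theorem exists_admissible {d : ℕ} (E : Set (Torus d))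
    (hS : Simple E) (hC : IsCompact E) (hF : FinComps E) :
    ∃ b : Torus d, Admissible b E := by
  choose b hb hmin using fun j => exists_rotation_diam_arg_minimal
    (hC.image (continuous_apply j)).isClosed (hS j)
  have heta : ∀ (c : Torus d) (j : Fin d), etaDiam E c j = Metric.diam
      ((fun z : Circle => Complex.arg ((c j * z : Circle) : ℂ)) '' ((fun z => z j) '' E)) :=
    fun c j => by rw [Set.image_image, etaDiam]
  have hvs : VerySimple (smulSet b E) := by
    rintro _ ⟨z, hz, rfl⟩ j
    exact hb j (z j) ⟨z, hz, rfl⟩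
  refine ⟨b, hvs, fun j => ⟨⟨b, hvs, rfl⟩, ?_⟩⟩
  rintro _ ⟨c, -, rfl⟩
  rw [heta, heta]
  exact hmin j (c j)
end
end

section
/- Let E ⊆ 𝕋^d be simple and compact with finitely many connected components E₁, …, E_N, and let b, c ∈ 𝕋^d be two admissible points for E such that all the phase shifts are equal: θ₁^{(b,c)} = … = θ_N^{(b,c)}. Then c⁻¹ · exp(i ConvexHull(arg(c·E))) = b⁻¹ · exp(i ConvexHull(arg(b·E))). -/
open scoped Real
noncomputable section

variable {d : ℕ}

open scoped Pointwise in
theorem expSet_vadd {d : ℕ} (v : Fin d → ℝ) (F : Set (Fin d → ℝ)) :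
    expSet (v +ᵥ F) = smulSet (fun j => Circle.exp (v j)) (expSet F) := by
  ext z
  constructor
  · rintro ⟨_, ⟨φ, hφ, rfl⟩, hz⟩
    refine ⟨fun j => Circle.exp (φ j), ⟨φ, hφ, fun j => rfl⟩, ?_⟩
    funext j
    simp [hz j, Circle.exp_add]
  · rintro ⟨w, ⟨φ, hφ, hw⟩, rfl⟩
    refine ⟨v +ᵥ φ, Set.vadd_mem_vadd_set hφ, fun j => ?_⟩
    simp [hw j, Circle.exp_add]

theorem smulSet_smulSet {d : ℕ} (a a' : Torus d) (E : Set (Torus d)) :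
    smulSet a (smulSet a' E) = smulSet (a * a') E := by
  simp only [smulSet, Set.image_image, mul_assoc]

theorem circle_exp_arg_add_two_pi_mul_int (z : Circle) (n : ℤ) :
    Circle.exp (Complex.arg z + 2 * π * n) = z := by
  rw [Circle.exp_add, Circle.exp_arg, Circle.exp_two_pi_mul_int, mul_one]

open scoped Pointwise in
theorem argSet_smulSet_eq_vadd {d : ℕ} (E : Set (Torus d)) (b c : Torus d) (v : Fin d → ℝ)
    (h : ∀ z ∈ E, ∀ j, Complex.arg ((c j * z j : Circle) : ℂ) =
      v j + Complex.arg ((b j * z j : Circle) : ℂ)) :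
    argSet (smulSet c E) = v +ᵥ argSet (smulSet b E) := by
  simp only [argSet, smulSet, Set.image_image, ← Set.image_vadd]
  exact Set.image_congr fun z hz => funext fun j => h z hz j

/-- If `b, c` are admissible points for a simple compact `E` with finitely many
connected components, and all the phase shifts of `E` with respect to `(b,c)` are equal, then
`c⁻¹·exp(i ConvexHull(arg(c·E))) = b⁻¹·exp(i ConvexHull(arg(b·E)))`. -/
theorem hull_well_defined {d N : ℕ} (E : Set (Torus d)) (Ec : Fin N → Set (Torus d))
    (hS : Simple E) (hC : IsCompact E) (hcomp : IsConnComps E Ec)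
    (b c : Torus d) (hb : Admissible b E) (hc : Admissible c E)
    (hshift : PhaseShifted b c E) :
    smulSet c⁻¹ (expSet (convexHull ℝ (argSet (smulSet c E)))) =
      smulSet b⁻¹ (expSet (convexHull ℝ (argSet (smulSet b E)))) := by
  obtain ⟨θ, hθ⟩ := hshift
  rw [argSet_smulSet_eq_vadd E b c
    (fun j => Complex.arg ((c j * (b j)⁻¹ : Circle) : ℂ) + 2 * π * θ j)
    fun z hz j => by rw [hθ z hz j]; ring,
    convexHull_vadd, expSet_vadd, smulSet_smulSet]
  congr 1
  funext j
  simp only [Pi.mul_apply, Pi.inv_apply, circle_exp_arg_add_two_pi_mul_int, inv_mul_cancel_left]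
end
end

section
/- Let E ⊆ 𝕋^d be simple, compact, with finitely many connected components, and suppose there exist admissible points b, c ∈ 𝕋^d for E such that not all the phase shifts θ_j^{(b,c)} are equal. Then there exists ε₀ > 0 such that for every ε ∈ (0, ε₀], there exists a compact simple subset E_ε ⊆ 𝕋^d which is generic and satisfies d_H^{𝕋^d}(E, E_ε) ≤ ε. -/
open scoped Real
noncomputable section

variable {d : ℕ}

/-- Principal argument of a rotated point of the circle. -/
theorem arg_exp_mul_exp {x γ : ℝ} (hx : x ∈ Set.Ioo (-π) π) (hγ : γ ∈ Set.Ico 0 (2 * π)) :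
    Complex.arg ((Circle.exp γ * Circle.exp x : Circle) : ℂ) =
      if x + γ ≤ π then x + γ else x + γ - 2 * π := by
  obtain ⟨h1, h2⟩ := hx
  obtain ⟨h3, h4⟩ := hγ
  rw [← Circle.exp_add]
  split_ifs with h
  · rw [add_comm γ x]
    exact Circle.arg_exp (by linarith) h
  · have : Circle.exp (γ + x) = Circle.exp (x + γ - 2 * π) := by
      rw [Circle.exp_sub_two_pi, add_comm]
    rw [this]
    exact Circle.arg_exp (by linarith) (by linarith)

theorem exists_exp_eq (z : Circle) : ∃ γ ∈ Set.Ico 0 (2 * π), Circle.exp γ = z := by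
  have h1 := Complex.neg_pi_lt_arg (z : ℂ)
  have h2 := Complex.arg_le_pi (z : ℂ)
  by_cases h : 0 ≤ Complex.arg (z : ℂ)
  · exact ⟨_, ⟨h, by linarith [Real.pi_pos]⟩, Circle.exp_arg z⟩
  · exact ⟨Complex.arg (z : ℂ) + 2 * π, ⟨by linarith, by linarith⟩, by
      rw [Circle.exp_add_two_pi, Circle.exp_arg]⟩

theorem Circle.arg_eq_pi_iff {z : Circle} : Complex.arg (z : ℂ) = π ↔ (z : ℂ) = -1 := by
  refine ⟨fun h => ?_, fun h => by rw [h, Complex.arg_neg_one]⟩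
  rw [← Circle.exp_arg z, h, Circle.coe_exp, Complex.exp_pi_mul_I]

theorem verySimple_smulSet_iff {b : Torus d} {E : Set (Torus d)} :
    VerySimple (smulSet b E) ↔
      ∀ z ∈ E, ∀ j, Complex.arg ((b j * z j : Circle) : ℂ) ∈ Set.Ioo (-π) π := by
  simp only [VerySimple, smulSet, Set.forall_mem_image, Pi.mul_apply]
  refine forall₃_congr fun z _ j => ?_
  rw [Ne, ← Circle.arg_eq_pi_iff]
  exact ⟨fun h => ⟨Complex.neg_pi_lt_arg _, lt_of_le_of_ne (Complex.arg_le_pi _) h⟩,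
    fun h => h.2.ne⟩

theorem phaseShifted_of_forall_exists {b c : Torus d} {E : Set (Torus d)}
    (h : ∀ j, ∃ K : ℝ, ∀ z ∈ E, Complex.arg ((c j * z j : Circle) : ℂ) =
      Complex.arg ((b j * z j : Circle) : ℂ) + K) : PhaseShifted b c E := by
  rcases E.eq_empty_or_nonempty with rfl | ⟨z₀, hz₀⟩
  · exact ⟨0, by simp⟩
  have key : ∀ j, ∃ m : ℤ, Complex.arg ((c j * z₀ j : Circle) : ℂ) =
      Complex.arg ((b j * z₀ j : Circle) : ℂ) + Complex.arg ((c j * (b j)⁻¹ : Circle) : ℂ)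
        + m * (2 * π) := by
    intro j
    rw [← Circle.exp_eq_exp, Circle.exp_add]
    simp only [Circle.exp_arg]
    rw [mul_comm (b j), mul_assoc, mul_comm (b j), mul_assoc, inv_mul_cancel, mul_one, mul_comm]
  choose m hm using key
  refine ⟨m, fun z hz j => ?_⟩
  obtain ⟨K, hK⟩ := h j
  have h1 := hK z hz
  have h2 := hK z₀ hz₀
  have h3 := hm j
  linarith

theorem isBounded_image_arg {E : Set (Torus d)} (c : Torus d) (j : Fin d) :
    Bornology.IsBounded
      ((fun z : Torus d => Complex.arg ((c j * z j : Circle) : ℂ)) '' E) := by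
  refine (Metric.isBounded_Icc (-π) π).subset ?_
  rintro _ ⟨z, _, rfl⟩
  exact ⟨(Complex.neg_pi_lt_arg _).le, Complex.arg_le_pi _⟩

theorem abs_sub_le_etaDiam {E : Set (Torus d)} (c : Torus d) (j : Fin d) {z w : Torus d}
    (hz : z ∈ E) (hw : w ∈ E) :
    |Complex.arg ((c j * z j : Circle) : ℂ) - Complex.arg ((c j * w j : Circle) : ℂ)| ≤
      etaDiam E c j := by
  rw [← Real.dist_eq]
  exact Metric.dist_le_diam_of_mem (isBounded_image_arg c j)
    (Set.mem_image_of_mem _ hz) (Set.mem_image_of_mem _ hw)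

theorem etaDiam_le {E : Set (Torus d)} {c : Torus d} {j : Fin d} {r : ℝ} (hr : 0 ≤ r)
    (h : ∀ z ∈ E, ∀ w ∈ E, Complex.arg ((c j * z j : Circle) : ℂ) -
      Complex.arg ((c j * w j : Circle) : ℂ) ≤ r) : etaDiam E c j ≤ r := by
  refine Metric.diam_le_of_forall_dist_le hr ?_
  rintro _ ⟨z, hz, rfl⟩ _ ⟨w, hw, rfl⟩
  rw [Real.dist_eq, abs_le]
  exact ⟨by linarith [h w hw z hz], h z hz w hw⟩

/-- The contraction of the torus towards `b⁻¹` with factor `t`, in the angular coordinates of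
`b * z`. -/
def contract (b : Torus d) (t : ℝ) (z : Torus d) : Torus d :=
  fun j => (b j)⁻¹ * Circle.exp (t * Complex.arg ((b j * z j : Circle) : ℂ))

theorem mul_contract (b : Torus d) (t : ℝ) (z : Torus d) (j : Fin d) :
    b j * contract b t z j = Circle.exp (t * Complex.arg ((b j * z j : Circle) : ℂ)) := by
  simp [contract]

theorem mul_mem_Ioo_neg_pi_pi {t x : ℝ} (ht : t ∈ Set.Ioo 0 1) (hx : x ∈ Set.Ioo (-π) π) :
    t * x ∈ Set.Ioo (-π) π := by
  obtain ⟨h1, h2⟩ := ht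
  obtain ⟨h3, h4⟩ := hx
  constructor <;> nlinarith [Real.pi_pos]

theorem arg_mul_contract {b : Torus d} {t : ℝ} (ht : t ∈ Set.Ioo 0 1) {E : Set (Torus d)}
    (hb : VerySimple (smulSet b E)) {z : Torus d} (hz : z ∈ E) (j : Fin d) :
    Complex.arg ((b j * contract b t z j : Circle) : ℂ) =
      t * Complex.arg ((b j * z j : Circle) : ℂ) := by
  have h := mul_mem_Ioo_neg_pi_pi ht (verySimple_smulSet_iff.1 hb z hz j)
  rw [mul_contract]
  exact Circle.arg_exp h.1 h.2.le

theorem verySimple_smulSet_contract {b : Torus d} {t : ℝ} (ht : t ∈ Set.Ioo 0 1)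
    {E : Set (Torus d)} (hb : VerySimple (smulSet b E)) :
    VerySimple (smulSet b (contract b t '' E)) := by
  rw [verySimple_smulSet_iff, Set.forall_mem_image]
  intro z hz j
  rw [arg_mul_contract ht hb hz]
  exact mul_mem_Ioo_neg_pi_pi ht (verySimple_smulSet_iff.1 hb z hz j)

theorem continuousOn_contract {b : Torus d} (t : ℝ) {E : Set (Torus d)}
    (hb : VerySimple (smulSet b E)) : ContinuousOn (contract b t) E := by
  refine continuousOn_pi.2 fun j z hz => ContinuousAt.continuousWithinAt ?_
  have h : ((b j * z j : Circle) : ℂ) ∈ Complex.slitPlane :=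
    Complex.mem_slitPlane_iff_arg.2
      ⟨(verySimple_smulSet_iff.1 hb z hz j).2.ne, Circle.coe_ne_zero _⟩
  have h1 : ContinuousAt (fun w : Torus d => ((b j * w j : Circle) : ℂ)) z :=
    (continuous_subtype_val.comp (continuous_const.mul (continuous_apply j))).continuousAt
  have h2 : ContinuousAt (fun w : Torus d => Complex.arg ((b j * w j : Circle) : ℂ)) z :=
    ContinuousAt.comp (f := fun w : Torus d => ((b j * w j : Circle) : ℂ))
      (Complex.continuousAt_arg h) h1
  unfold contract
  exact continuousAt_const.mul (Circle.exp.continuous.continuousAt.comp (continuousAt_const.mul h2))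

theorem VerySimple.simple_of_smulSet {b : Torus d} {E : Set (Torus d)}
    (hb : VerySimple (smulSet b E)) : Simple E := by
  intro j hj
  obtain ⟨z, hz, hzj⟩ : (b j)⁻¹ * Circle.exp π ∈ (fun z : Torus d => z j) '' E := by
    rw [hj]; trivial
  refine hb _ (Set.mem_image_of_mem _ hz) j ?_
  simp only at hzj
  simp [hzj, Circle.coe_exp, Complex.exp_pi_mul_I]

theorem FinComps.image {E : Set (Torus d)} (hE : FinComps E) {f : Torus d → Torus d}
    (hf : ContinuousOn f E) : FinComps (f '' E) := by
  refine (Set.Finite.image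
    (fun C => ⋃ z ∈ C, connectedComponentIn (f '' E) (f z)) hE).subset ?_
  rintro _ ⟨_, ⟨z, hz, rfl⟩, rfl⟩
  refine ⟨_, ⟨z, hz, rfl⟩, ?_⟩
  have hsub := connectedComponentIn_subset E z
  have hz' := mem_connectedComponentIn hz
  have key : f '' connectedComponentIn E z ⊆ connectedComponentIn (f '' E) (f z) :=
    (isPreconnected_connectedComponentIn.image f (hf.mono hsub)).subset_connectedComponentIn
      (Set.mem_image_of_mem f hz') (Set.image_mono hsub)
  refine Set.Subset.antisymm (Set.iUnion₂_subset fun w hw => ?_) ?_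
  · exact (connectedComponentIn_eq (key (Set.mem_image_of_mem f hw))).ge
  · exact Set.subset_iUnion₂_of_subset z hz' subset_rfl

theorem eunorm_le_of_abs_le {v : Fin d → ℝ} {r : ℝ} (hr : 0 ≤ r) (h : ∀ j, |v j| ≤ r) :
    eunorm v ≤ (d + 1) * r := by
  have h1 : ∑ j, v j ^ 2 ≤ ∑ _j : Fin d, r ^ 2 :=
    Finset.sum_le_sum fun j _ => sq_le_sq' (abs_le.1 (h j)).1 (abs_le.1 (h j)).2
  rw [Finset.sum_const, Finset.card_univ, Fintype.card_fin, nsmul_eq_mul] at h1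
  refine Real.sqrt_le_iff.2 ⟨by positivity, h1.trans ?_⟩
  rw [mul_pow]
  have : (0 : ℝ) ≤ d := Nat.cast_nonneg d
  gcongr
  nlinarith

theorem torusDist_contract_le {b : Torus d} {t : ℝ} (ht : t ≤ 1) (z : Torus d) :
    torusDist z (contract b t z) ≤ (d + 1) * ((1 - t) * π) := by
  have key : ∀ j, ∃ m : ℤ, targ (contract b t z) j + (1 - t) * Complex.arg ((b j * z j : Circle) : ℂ)
      = targ z j + m * (2 * π) := by
    intro j
    rw [← Circle.exp_eq_exp, Circle.exp_add, targ, targ, Circle.exp_arg, Circle.exp_arg, contract,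
      mul_assoc, ← Circle.exp_add, ← add_mul, add_sub_cancel, one_mul, Circle.exp_arg,
      inv_mul_cancel_left]
  choose m hm using key
  have hle : torusDist z (contract b t z) ≤
      eunorm fun j => targ z j - targ (contract b t z) j + 2 * π * m j :=
    csInf_le ⟨0, by rintro _ ⟨θ, rfl⟩; exact Real.sqrt_nonneg _⟩ ⟨m, rfl⟩
  refine hle.trans (eunorm_le_of_abs_le (mul_nonneg (by linarith) Real.pi_pos.le) fun j => ?_)
  have h1 : targ z j - targ (contract b t z) j + 2 * π * m j =
      (1 - t) * Complex.arg ((b j * z j : Circle) : ℂ) := by linarith [hm j]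
  rw [h1, abs_mul, abs_of_nonneg (by linarith : 0 ≤ 1 - t)]
  exact mul_le_mul_of_nonneg_left (Complex.abs_arg_le_pi _) (by linarith)

theorem exists_arg_eq_add_of_admissible_contract {b c : Torus d} {t : ℝ} (ht : t ∈ Set.Ioo 0 1)
    {E : Set (Torus d)} (hb : Admissible b E) (hc : Admissible c (contract b t '' E)) (j : Fin d) :
    ∃ K : ℝ, ∀ z ∈ contract b t '' E, Complex.arg ((c j * z j : Circle) : ℂ) =
      Complex.arg ((b j * z j : Circle) : ℂ) + K := by
  obtain ⟨γ, hγ, hγc⟩ := exists_exp_eq (c j * (b j)⁻¹)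
  have hπ := Real.pi_pos
  have hbE := fun z (hz : z ∈ E) => verySimple_smulSet_iff.1 hb.1 z hz j
  have hcE := fun z (hz : z ∈ E) =>
    verySimple_smulSet_iff.1 hc.1 _ (Set.mem_image_of_mem (contract b t) hz) j
  set u : Torus d → ℝ := fun z => Complex.arg ((b j * z j : Circle) : ℂ) with hu
  have hcj : ∀ z ∈ E, Complex.arg ((c j * contract b t z j : Circle) : ℂ) =
      if t * u z + γ ≤ π then t * u z + γ else t * u z + γ - 2 * π := by
    intro z hz
    rw [← arg_exp_mul_exp (mul_mem_Ioo_neg_pi_pi ht (hbE z hz)) hγ, hγc, ← mul_contract, mul_assoc,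
      inv_mul_cancel_left]
  have hbj : ∀ z ∈ E, Complex.arg ((b j * contract b t z j : Circle) : ℂ) = t * u z :=
    fun z hz => arg_mul_contract ht hb.1 hz j
  simp only [Set.forall_mem_image]
  by_cases h₁ : ∀ z ∈ E, t * u z + γ ≤ π
  · exact ⟨γ, fun z hz => by rw [hcj z hz, hbj z hz, if_pos (h₁ z hz)]⟩
  by_cases h₂ : ∀ z ∈ E, ¬ t * u z + γ ≤ π
  · exact ⟨γ - 2 * π, fun z hz => by rw [hcj z hz, hbj z hz, if_neg (h₂ z hz)]; ring⟩
  exfalso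
  push Not at h₁ h₂
  obtain ⟨p, hp, hpγ⟩ := h₂
  obtain ⟨q, hq, hqγ⟩ := h₁
  obtain ⟨ht0, ht1⟩ := ht
  -- Cut `E` at the place which the contraction moves to the cut defining `c`.
  obtain ⟨γ₀, hγ₀⟩ : ∃ γ₀ : ℝ, t * (π - γ₀) = π - γ := ⟨π - (π - γ) / t, by field_simp; ring⟩
  have hcut : ∀ z, u z + γ₀ ≤ π ↔ t * u z + γ ≤ π := by
    intro z
    rw [← le_sub_iff_add_le, ← le_sub_iff_add_le, ← hγ₀, mul_le_mul_iff_right₀ ht0]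
  have hγ₀mem : γ₀ ∈ Set.Ico 0 (2 * π) := by
    have h1 := (hcut p).2 hpγ
    have h2 := mt (hcut q).1 hqγ.not_ge
    have h3 := hbE p hp
    have h4 := hbE q hq
    exact ⟨by linarith [h4.2], by linarith [h3.1]⟩
  set c₀ : Torus d := Function.update b j (Circle.exp γ₀ * b j) with hc₀
  have hc₀j : ∀ z ∈ E, Complex.arg ((c₀ j * z j : Circle) : ℂ) =
      if t * u z + γ ≤ π then u z + γ₀ else u z + γ₀ - 2 * π := by
    intro z hz
    simp only [← hcut]
    rw [← arg_exp_mul_exp (hbE z hz) hγ₀mem, Circle.exp_arg, hc₀, Function.update_self, mul_assoc]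
  have hne : ∀ z ∈ E, u z + γ₀ ≠ π := by
    intro z hz h
    have h1 : t * u z + γ = π := by rw [← eq_sub_iff_add_eq] at h ⊢; rw [h, hγ₀]
    have h2 := (hcE z hz).2
    rw [hcj z hz, if_pos h1.le, h1] at h2
    exact lt_irrefl _ h2
  have hc₀E : VerySimple (smulSet c₀ E) := by
    rw [verySimple_smulSet_iff]
    intro z hz i
    rcases eq_or_ne i j with rfl | hij
    · refine ⟨Complex.neg_pi_lt_arg _, lt_of_le_of_ne (Complex.arg_le_pi _) ?_⟩
      rw [hc₀j z hz]
      split_ifs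
      · exact hne z hz
      · have := (hbE z hz).2
        have := hγ₀mem.2
        simp only [hu] at *
        intro h; linarith
    · rw [hc₀, Function.update_of_ne hij]
      exact verySimple_smulSet_iff.1 hb.1 z hz i
  set D' := etaDiam (contract b t '' E) c j with hD'
  have hD'_le : D' ≤ t * etaDiam E b j := by
    refine ((hc.2 j).2 ⟨b, verySimple_smulSet_contract ⟨ht0, ht1⟩ hb.1, rfl⟩).trans ?_
    refine etaDiam_le (mul_nonneg ht0.le Metric.diam_nonneg) ?_
    simp only [Set.forall_mem_image]
    intro z hz w hw
    rw [hbj z hz, hbj w hw, ← mul_sub]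
    exact mul_le_mul_of_nonneg_left
      ((le_abs_self _).trans (abs_sub_le_etaDiam b j hz hw)) ht0.le
  have hmixed : ∀ z ∈ E, ∀ w ∈ E, t * u z + γ ≤ π → ¬ t * u w + γ ≤ π →
      t * (u z - u w + 2 * π) + (1 - t) * (2 * π) ≤ D' := by
    intro z hz w hw h1 h2
    have := (le_abs_self _).trans (abs_sub_le_etaDiam c j
      (Set.mem_image_of_mem (contract b t) hz) (Set.mem_image_of_mem (contract b t) hw))
    rw [hcj z hz, hcj w hw, if_pos h1, if_neg h2] at this
    linarith
  have hub : ∀ z ∈ E, ∀ w ∈ E, |u z - u w| < 2 * π := by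
    intro z hz w hw
    obtain ⟨h1, h2⟩ := hbE z hz
    obtain ⟨h3, h4⟩ := hbE w hw
    rw [abs_lt]
    constructor <;> simp only [hu] <;> linarith
  have hD₀ : etaDiam E c₀ j ≤ (D' - (1 - t) * (2 * π)) / t := by
    refine etaDiam_le ?_ fun z hz w hw => ?_
    · have h1 := hmixed p hp q hq hpγ hqγ.not_ge
      have h2 := (abs_lt.1 (hub p hp q hq)).1
      refine div_nonneg ?_ ht0.le
      nlinarith
    rw [le_div_iff₀' ht0, hc₀j z hz, hc₀j w hw]
    split_ifs with h1 h2 h2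
    · have h3 := hmixed z hz q hq h1 hqγ.not_ge
      have h4 := (abs_lt.1 (hub w hw q hq)).1
      nlinarith
    · have h3 := hmixed z hz w hw h1 h2
      nlinarith
    · have h3 := hmixed p hp q hq hpγ hqγ.not_ge
      have h4 := (abs_lt.1 (hub p hp q hq)).1
      have h5 := (abs_lt.1 (hub z hz w hw)).2
      nlinarith
    · have h3 := hmixed p hp w hw hpγ h2
      have h4 := (abs_lt.1 (hub z hz p hp)).2
      nlinarith
  have hD := ((hb.2 j).2 ⟨c₀, hc₀E, rfl⟩).trans hD₀
  rw [le_div_iff₀' ht0] at hD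
  nlinarith

theorem generic_contract {b : Torus d} {t : ℝ} (ht : t ∈ Set.Ioo 0 1) {E : Set (Torus d)}
    (hb : Admissible b E) : Generic (contract b t '' E) := by
  intro b' c' hb' hc'
  refine phaseShifted_of_forall_exists fun j => ?_
  obtain ⟨K, hK⟩ := exists_arg_eq_add_of_admissible_contract ht hb hb' j
  obtain ⟨L, hL⟩ := exists_arg_eq_add_of_admissible_contract ht hb hc' j
  exact ⟨L - K, fun z hz => by rw [hK z hz, hL z hz]; ring⟩

/-- A non generic simple compact set with finitely many connected components can
be approximated, in the Hausdorff distance, by generic compact simple sets. -/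
theorem generic_approximation {d : ℕ} (E : Set (Torus d))
    (hS : Simple E) (hC : IsCompact E) (hF : FinComps E)
    (hnongen : ∃ b c : Torus d, Admissible b E ∧ Admissible c E ∧ ¬ PhaseShifted b c E) :
    ∃ ε₀ > (0 : ℝ), ∀ ε : ℝ, 0 < ε → ε ≤ ε₀ →
      ∃ Eε : Set (Torus d), IsCompact Eε ∧ Simple Eε ∧ FinComps Eε ∧ Generic Eε ∧
        torusHD E Eε ≤ ε := by
  obtain ⟨b, -, hb, -, -⟩ := hnongen
  refine ⟨1, one_pos, fun ε hε _ => ?_⟩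
  have hπ := Real.pi_pos
  set δ : ℝ := min (1 / 2) (ε / ((d + 1) * π)) with hδ
  have hδ0 : 0 < δ := lt_min (by norm_num) (by positivity)
  have hδ1 : δ ≤ 1 / 2 := min_le_left _ _
  have hδε : (d + 1) * (δ * π) ≤ ε := by
    have : δ ≤ ε / ((d + 1) * π) := min_le_right _ _
    rw [le_div_iff₀ (by positivity)] at this
    linarith
  have ht : 1 - δ ∈ Set.Ioo (0 : ℝ) 1 := ⟨by linarith, by linarith⟩
  have hcont := continuousOn_contract (1 - δ) hb.1
  have hdist : ∀ z, torusDist z (contract b (1 - δ) z) ≤ ε := fun z =>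
    (torusDist_contract_le ht.2.le z).trans (by rwa [sub_sub_cancel])
  refine ⟨contract b (1 - δ) '' E, hC.image_of_continuousOn hcont,
    (verySimple_smulSet_contract ht hb.1).simple_of_smulSet, hF.image hcont,
    generic_contract ht hb, csInf_le ⟨0, fun r hr => hr.1.le⟩ ⟨hε, ?_, ?_⟩⟩
  · exact fun z hz => ⟨_, Set.mem_image_of_mem _ hz, hdist z⟩
  · rintro _ ⟨z, hz, rfl⟩
    exact ⟨z, hz, hdist z⟩
end
end

section
/- Let E, F ⊆ 𝕋^d be compact connected very simple subsets such that d_H^{𝕋^d}(E, F) ≤ (1/2)·dist(arg(F), ∂[−π,π]^d). Then d_H^{𝕋^d}(ConvexHull_{𝕋^d}(E), ConvexHull_{𝕋^d}(F)) ≤ d_H^{𝕋^d}(E, F). -/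
open scoped Real
noncomputable section

variable {d : ℕ}

lemma eunorm_eq_norm (v : Fin d → ℝ) : eunorm v = ‖WithLp.toLp 2 v‖ := by
  simp [eunorm, EuclideanSpace.norm_eq]

lemma eunorm_nonneg (v : Fin d → ℝ) : 0 ≤ eunorm v := Real.sqrt_nonneg _

lemma eunorm_add_le (v w : Fin d → ℝ) : eunorm (v + w) ≤ eunorm v + eunorm w := by
  simpa only [eunorm_eq_norm, WithLp.toLp_add] using norm_add_le _ _

lemma eunorm_smul (c : ℝ) (v : Fin d → ℝ) : eunorm (c • v) = |c| * eunorm v := by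
  simp only [eunorm_eq_norm, WithLp.toLp_smul, norm_smul, Real.norm_eq_abs]

lemma eunorm_sub_comm (v w : Fin d → ℝ) : eunorm (v - w) = eunorm (w - v) := by
  simpa only [eunorm_eq_norm, WithLp.toLp_sub] using norm_sub_rev _ _

lemma abs_apply_le_eunorm (v : Fin d → ℝ) (j : Fin d) : |v j| ≤ eunorm v := by
  simpa [eunorm_eq_norm] using PiLp.norm_apply_le (WithLp.toLp 2 v) j

lemma eunorm_sub_update (x : Fin d → ℝ) (j : Fin d) (c : ℝ) :
    eunorm (x - Function.update x j c) = |x j - c| := by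
  rw [eunorm, Finset.sum_eq_single j, Pi.sub_apply, Function.update_self, Real.sqrt_sq_eq_abs]
  · intro k _ hk
    simp [Function.update_of_ne hk]
  · simp

lemma bddBelow_torusDist_set (z w : Torus d) :
    BddBelow {r | ∃ θ : Fin d → ℤ,
      r = eunorm (fun j => targ z j - targ w j + 2 * π * θ j)} := by
  refine ⟨0, ?_⟩
  rintro _ ⟨θ, rfl⟩
  exact eunorm_nonneg _

lemma torusDist_le (z w : Torus d) (θ : Fin d → ℤ) :
    torusDist z w ≤ eunorm (fun j => targ z j - targ w j + 2 * π * θ j) :=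
  csInf_le (bddBelow_torusDist_set z w) ⟨θ, rfl⟩

lemma torusDist_le_eunorm (z w : Torus d) : torusDist z w ≤ eunorm (targ z - targ w) := by
  refine (torusDist_le z w 0).trans_eq ?_
  congr 1
  ext j
  simp

lemma torusDist_le_bound (z w : Torus d) :
    torusDist z w ≤ Real.sqrt (∑ _j : Fin d, (2 * π) ^ 2) := by
  refine (torusDist_le_eunorm z w).trans (Real.sqrt_le_sqrt (Finset.sum_le_sum fun j _ => ?_))
  refine sq_le_sq' ?_ ?_ <;>
  · simp only [Pi.sub_apply, targ]
    linarith [Complex.neg_pi_lt_arg (z j), Complex.arg_le_pi (z j),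
      Complex.neg_pi_lt_arg (w j), Complex.arg_le_pi (w j)]

/-- The toric distance between exponentials is at most the Euclidean distance. -/
lemma torusDist_exp_le {z w : Torus d} {x y : Fin d → ℝ}
    (hz : ∀ j, z j = Circle.exp (x j)) (hw : ∀ j, w j = Circle.exp (y j)) :
    torusDist z w ≤ eunorm (x - y) := by
  have targ_eq : ∀ (u : Torus d) (t : Fin d → ℝ), (∀ j, u j = Circle.exp (t j)) → ∀ j,
      targ u j = t j - 2 * π * toIocDiv Real.two_pi_pos (-π) (t j) := by
    intro u t hu j
    rw [targ, hu, Circle.coe_exp, Complex.arg_exp_mul_I, toIocMod, zsmul_eq_mul]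
    ring
  refine (torusDist_le z w fun j => toIocDiv Real.two_pi_pos (-π) (x j) -
    toIocDiv Real.two_pi_pos (-π) (y j)).trans_eq ?_
  congr 1
  ext j
  rw [targ_eq z x hz, targ_eq w y hw]
  push_cast [Pi.sub_apply]
  ring

/-- If `w` stays `m`-away from the cut locus, then toric closeness below `m` is
Euclidean closeness of the arguments. -/
lemma eunorm_targ_sub_le {z w : Torus d} {m ε : ℝ} (hw : ∀ j, |targ w j| ≤ π - m)
    (hε : ε < m) (h : torusDist z w ≤ ε) : eunorm (targ z - targ w) ≤ ε := by
  have key : min (eunorm (targ z - targ w)) m ≤ torusDist z w := by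
    refine le_csInf ⟨_, 0, rfl⟩ ?_
    rintro _ ⟨θ, rfl⟩
    by_cases hθ : θ = 0
    · refine (min_le_left _ _).trans_eq ?_
      congr 1
      ext j
      simp [hθ]
    · obtain ⟨j, hj⟩ := Function.ne_iff.mp hθ
      refine (min_le_right _ _).trans (le_trans ?_ (abs_apply_le_eunorm _ j))
      have h1 : (1 : ℝ) ≤ |(θ j : ℝ)| := by
        exact_mod_cast Int.one_le_abs hj
      have h2 : 2 * π ≤ |2 * π * (θ j : ℝ)| := by
        rw [abs_mul, abs_of_pos Real.two_pi_pos]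
        nlinarith [Real.pi_pos]
      have h3 : |targ z j| ≤ π := Complex.abs_arg_le_pi _
      have h4 := hw j
      have h5 := abs_sub_abs_le_abs_sub (2 * π * (θ j : ℝ)) (targ w j - targ z j)
      have h6 := abs_sub (targ w j) (targ z j)
      have h7 : 2 * π * (θ j : ℝ) - (targ w j - targ z j) =
        targ z j - targ w j + 2 * π * θ j := by ring
      rw [h7] at h5
      linarith
  rcases min_le_iff.mp (key.trans h) with h | h
  · exact h
  · exact absurd hε h.not_gt

/-- One-sided Euclidean Hausdorff closeness passes to convex hulls. -/
lemma exists_convexHull_eunorm_sub_le {A B : Set (Fin d → ℝ)} {ε : ℝ}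
    (h : ∀ a ∈ A, ∃ b ∈ B, eunorm (a - b) ≤ ε) :
    ∀ x ∈ convexHull ℝ A, ∃ y ∈ convexHull ℝ B, eunorm (x - y) ≤ ε := by
  have hconv : Convex ℝ {x | ∃ y ∈ convexHull ℝ B, eunorm (x - y) ≤ ε} := by
    rintro x ⟨x', hx', hx⟩ y ⟨y', hy', hy⟩ s t hs ht hst
    refine ⟨s • x' + t • y', convex_convexHull ℝ B hx' hy' hs ht hst, ?_⟩
    have heq : s • x + t • y - (s • x' + t • y') = s • (x - x') + t • (y - y') := by
      module
    calc eunorm (s • x + t • y - (s • x' + t • y'))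
        ≤ eunorm (s • (x - x')) + eunorm (t • (y - y')) := heq ▸ eunorm_add_le _ _
      _ = s * eunorm (x - x') + t * eunorm (y - y') := by
          rw [eunorm_smul, eunorm_smul, abs_of_nonneg hs, abs_of_nonneg ht]
      _ ≤ s * ε + t * ε := by gcongr
      _ = ε := by rw [← add_mul, hst, one_mul]
  refine fun x hx => convexHull_min (fun a ha => ?_) hconv hx
  obtain ⟨b, hb, hab⟩ := h a ha
  exact ⟨b, subset_convexHull ℝ B hb, hab⟩

lemma update_mem_cubeBoundary {x : Fin d → ℝ} (hx : ∀ k, |x k| ≤ π) (j : Fin d) {c : ℝ}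
    (hc : |c| = π) : Function.update x j c ∈ cubeBoundary d := by
  have hclosed : IsClosed (Set.univ.pi fun _ : Fin d => Set.Icc (-π) π) :=
    isClosed_set_pi fun _ _ => isClosed_Icc
  rw [cubeBoundary, hclosed.frontier_eq]
  refine ⟨fun k _ => abs_le.mp ?_, fun h => ?_⟩
  · by_cases hk : k = j
    · subst hk
      simp [hc]
    · simpa [Function.update_of_ne hk] using hx k
  · rw [interior_pi_set Set.finite_univ] at h
    have hj := h j (Set.mem_univ j)
    rw [Function.update_self, interior_Icc, Set.mem_Ioo, ← abs_lt] at hj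
    exact hj.ne hc

lemma setDistR_cubeBoundary_le {A : Set (Fin d → ℝ)} {x : Fin d → ℝ} (hxA : x ∈ A)
    (hx : ∀ k, |x k| ≤ π) (j : Fin d) : setDistR A (cubeBoundary d) ≤ π - |x j| := by
  have hbdd : BddBelow {r | ∃ u ∈ A, ∃ v ∈ cubeBoundary d, r = eunorm (u - v)} := by
    refine ⟨0, ?_⟩
    rintro _ ⟨u, -, v, -, rfl⟩
    exact eunorm_nonneg _
  have hle : ∀ c : ℝ, |c| = π → setDistR A (cubeBoundary d) ≤ |x j - c| := fun c hc =>
    csInf_le hbdd ⟨x, hxA, _, update_mem_cubeBoundary hx j hc, (eunorm_sub_update x j c).symm⟩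
  have hj := abs_le.mp (hx j)
  have hπ : |π| = π := abs_of_pos Real.pi_pos
  rcases abs_cases (x j) with ⟨h, -⟩ | ⟨h, -⟩
  · refine (hle π hπ).trans_eq ?_
    rw [h, abs_of_nonpos (by linarith)]
    ring
  · refine (hle (-π) (by rw [abs_neg, hπ])).trans_eq ?_
    rw [h, abs_of_nonneg (by linarith)]
    ring

lemma Circle.arg_ne_pi {z : Circle} (hz : (z : ℂ) ≠ -1) : Complex.arg z ≠ π := by
  intro h
  apply hz
  have := Complex.norm_mul_exp_arg_mul_I (z : ℂ)
  rw [h, Circle.norm_coe, Complex.exp_pi_mul_I] at this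
  simpa using this.symm

lemma Circle.abs_arg_lt_pi {z : Circle} (hz : (z : ℂ) ≠ -1) : |Complex.arg z| < π :=
  abs_lt.mpr ⟨Complex.neg_pi_lt_arg _, (Complex.arg_le_pi _).lt_of_ne (Circle.arg_ne_pi hz)⟩

lemma VerySimple.continuousOn_targ {F : Set (Torus d)} (hF : VerySimple F) (j : Fin d) :
    ContinuousOn (fun z : Torus d => targ z j) F := by
  intro z hz
  have hslit : ((z j : Circle) : ℂ) ∈ Complex.slitPlane :=
    Complex.mem_slitPlane_iff_arg.mpr ⟨Circle.arg_ne_pi (hF z hz j), Circle.coe_ne_zero _⟩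
  have hcont : ContinuousAt (fun z : Torus d => ((z j : Circle) : ℂ)) z :=
    (continuous_subtype_val.comp (continuous_apply j)).continuousAt
  exact (ContinuousAt.comp (f := fun z : Torus d => ((z j : Circle) : ℂ))
    (Complex.continuousAt_arg hslit) hcont).continuousWithinAt

lemma torusHD_nonneg (A B : Set (Torus d)) : 0 ≤ torusHD A B :=
  Real.sInf_nonneg fun _ h => h.1.le

lemma torusHD_le {A B : Set (Torus d)} {ε : ℝ} (hε : 0 < ε)
    (hAB : ∀ a ∈ A, ∃ b ∈ B, torusDist a b ≤ ε) (hBA : ∀ b ∈ B, ∃ a ∈ A, torusDist a b ≤ ε) :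
    torusHD A B ≤ ε :=
  csInf_le (BddBelow.mono (fun _ h => h.1) bddBelow_Ioi) ⟨hε, hAB, hBA⟩

lemma exists_lt_of_torusHD_lt {A B : Set (Torus d)} (hA : A.Nonempty) (hB : B.Nonempty) {r : ℝ}
    (hr : torusHD A B < r) :
    ∃ ε, 0 < ε ∧ (∀ a ∈ A, ∃ b ∈ B, torusDist a b ≤ ε) ∧
      (∀ b ∈ B, ∃ a ∈ A, torusDist a b ≤ ε) ∧ ε < r := by
  obtain ⟨a₀, ha₀⟩ := hA
  obtain ⟨b₀, hb₀⟩ := hB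
  have hbound : ∀ z w : Torus d, torusDist z w ≤ Real.sqrt (∑ _j : Fin d, (2 * π) ^ 2) + 1 :=
    fun z w => (torusDist_le_bound z w).trans (le_add_of_nonneg_right zero_le_one)
  have hne : {ε | 0 < ε ∧ (∀ a ∈ A, ∃ b ∈ B, torusDist a b ≤ ε) ∧
      (∀ b ∈ B, ∃ a ∈ A, torusDist a b ≤ ε)}.Nonempty :=
    ⟨_, by positivity, fun a _ => ⟨b₀, hb₀, hbound a b₀⟩, fun b _ => ⟨a₀, ha₀, hbound a₀ b⟩⟩
  obtain ⟨ε, ⟨h0, hAB, hBA⟩, hlt⟩ := exists_lt_of_csInf_lt hne hr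
  exact ⟨ε, h0, hAB, hBA, hlt⟩

/-- A compact very simple set keeps a distance from the cut locus exceeding any `ε` which is at
most half its distance to the boundary of the cube. -/
lemma VerySimple.exists_margin {F : Set (Torus d)} (hF : VerySimple F) (hFc : IsCompact F)
    (hne : F.Nonempty) {ε : ℝ} (hε : ε ≤ (1 / 2) * setDistR (argSet F) (cubeBoundary d)) :
    ∃ m, ε < m ∧ ∀ z ∈ F, ∀ j, |targ z j| ≤ π - m := by
  have hcoord : ∀ j : Fin d, ∃ c, ε < c ∧ ∀ z ∈ F, |targ z j| ≤ π - c := by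
    intro j
    obtain ⟨z, hz, hmax⟩ := hFc.exists_isMaxOn hne (hF.continuousOn_targ j).abs
    refine ⟨π - |targ z j|, ?_, fun w hw => by simpa using hmax hw⟩
    have hpos : |targ z j| < π := Circle.abs_arg_lt_pi (hF z hz j)
    have hle : setDistR (argSet F) (cubeBoundary d) ≤ π - |targ z j| :=
      setDistR_cubeBoundary_le (Set.mem_image_of_mem targ hz) (fun k => Complex.abs_arg_le_pi _) j
    linarith
  choose c hc hFle using hcoord
  have hev : ∀ᶠ m in nhdsWithin ε (Set.Ioi ε), ∀ j, m < c j :=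
    Filter.eventually_all.mpr fun j => nhdsWithin_le_nhds (eventually_lt_nhds (hc j))
  obtain ⟨m, hm, hεm⟩ := (hev.and self_mem_nhdsWithin).exists
  exact ⟨m, hεm, fun z hz j => (hFle j z hz).trans (by linarith [hm j])⟩

/-- Weak Lipschitz property of the toric convex hull: if `E, F ⊆ 𝕋^d` are
compact connected very simple subsets with
`d_H^{𝕋^d}(E,F) ≤ (1/2)·dist(arg F, ∂[−π,π]^d)`, then the Hausdorff distance between their
toric convex hulls is at most `d_H^{𝕋^d}(E,F)`. -/
theorem hull_weak_lipschitz {d : ℕ} (E F : Set (Torus d))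
    (hEc : IsCompact E) (hEconn : IsConnected E) (hEvs : VerySimple E)
    (hFc : IsCompact F) (hFconn : IsConnected F) (hFvs : VerySimple F)
    (hclose : torusHD E F ≤ (1 / 2) * setDistR (argSet F) (cubeBoundary d)) :
    torusHD (expSet (convexHull ℝ (argSet E))) (expSet (convexHull ℝ (argSet F))) ≤
      torusHD E F := by
  obtain ⟨m, hm, hFm⟩ := hFvs.exists_margin hFc hFconn.nonempty hclose
  refine le_of_forall_gt_imp_ge_of_dense fun r hr => ?_
  obtain ⟨ε, h0, hEF, hFE, hlt⟩ :=
    exists_lt_of_torusHD_lt hEconn.nonempty hFconn.nonempty (lt_min hm hr)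
  have hεm : ε < m := hlt.trans_le (min_le_left _ _)
  refine le_trans (torusHD_le h0 ?_ ?_) (hlt.le.trans (min_le_right _ _))
  · have hA : ∀ a ∈ argSet E, ∃ b ∈ argSet F, eunorm (a - b) ≤ ε := by
      rintro _ ⟨z, hz, rfl⟩
      obtain ⟨w, hw, hzw⟩ := hEF z hz
      exact ⟨_, ⟨w, hw, rfl⟩, eunorm_targ_sub_le (hFm w hw) hεm hzw⟩
    rintro z ⟨x, hx, hzx⟩
    obtain ⟨y, hy, hxy⟩ := exists_convexHull_eunorm_sub_le hA x hx
    exact ⟨fun j => Circle.exp (y j), ⟨y, hy, fun _ => rfl⟩,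
      (torusDist_exp_le hzx fun _ => rfl).trans hxy⟩
  · have hB : ∀ b ∈ argSet F, ∃ a ∈ argSet E, eunorm (b - a) ≤ ε := by
      rintro _ ⟨w, hw, rfl⟩
      obtain ⟨z, hz, hzw⟩ := hFE w hw
      refine ⟨_, ⟨z, hz, rfl⟩, ?_⟩
      rw [eunorm_sub_comm]
      exact eunorm_targ_sub_le (hFm w hw) hεm hzw
    rintro w ⟨y, hy, hwy⟩
    obtain ⟨x, hx, hyx⟩ := exists_convexHull_eunorm_sub_le hB y hy
    rw [eunorm_sub_comm] at hyx
    exact ⟨fun j => Circle.exp (x j), ⟨x, hx, fun _ => rfl⟩,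
      (torusDist_exp_le (fun _ => rfl) hwy).trans hyx⟩
end
end
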